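/- Let A be a nonempty compact metric space, T > 0, and let t ↦ μ_t be a Borel-measurable map from [0,T] into the space of Borel probability measures on A (equipped with the topology of weak convergence). Then there exists a sequence of Borel-measurable functions u_n : [0,T] → A such that for every continuous function f : [0,T] × A → ℝ, ∫_0^T f(t, u_n(t)) dt → ∫_0^T ∫_A f(t, ξ) dμ_t(ξ) dt as n → ∞; that is, the random measures δ_{u_n(t)}(dξ) dt converge stably (hence weakly) to μ_t(dξ) dt on [0,T] × A. -/

import Mathlib

open MeasureTheory Filter

open ProbabilityTheory

open TopologicalSpace (PseudoMetrizableSpace)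
open scoped unitInterval

lemma integrable_of_continuous {A : Type*} [TopologicalSpace A] [CompactSpace A]
    [MeasurableSpace A] [BorelSpace A] {m : Measure A} [IsFiniteMeasure m] {φ : A → ℝ}
    (hφ : Continuous φ) : Integrable φ m := by
  obtain ⟨C, hC⟩ := isCompact_univ.exists_bound_of_continuousOn hφ.continuousOn
  exact .of_bound hφ.measurable.aestronglyMeasurable C (.of_forall fun x => hC x trivial)

lemma exists_norm_le_of_mem_uIoc {A : Type*} [TopologicalSpace A] [CompactSpace A]
    {f : ℝ × A → ℝ} (hf : Continuous f) (a b : ℝ) :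
    ∃ C, ∀ t ∈ Set.uIoc a b, ∀ ξ, ‖f (t, ξ)‖ ≤ C := by
  obtain ⟨C, hC⟩ := (isCompact_uIcc.prod isCompact_univ).exists_bound_of_continuousOn
    (s := Set.uIcc a b ×ˢ (Set.univ : Set A)) hf.continuousOn
  exact ⟨C, fun t ht ξ => hC (t, ξ) ⟨Set.uIoc_subset_uIcc ht, trivial⟩⟩

lemma intervalIntegrable_comp {A : Type*} [TopologicalSpace A] [CompactSpace A]
    [PseudoMetrizableSpace A] [MeasurableSpace A] [BorelSpace A]
    {f : ℝ × A → ℝ} (hf : Continuous f) {v : ℝ → A} (hv : Measurable v) (a b : ℝ) :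
    IntervalIntegrable (fun t => f (t, v t)) volume a b := by
  obtain ⟨C, hC⟩ := exists_norm_le_of_mem_uIoc hf a b
  rw [intervalIntegrable_iff]
  exact Measure.integrableOn_of_bounded (M := C) (by simp)
    (hf.measurable.comp (measurable_id.prodMk hv)).aestronglyMeasurable
    ((ae_restrict_iff' measurableSet_uIoc).2 (.of_forall fun t ht => hC t ht _))

lemma intervalIntegrable_integral_kernel {A : Type*} [TopologicalSpace A] [CompactSpace A]
    [PseudoMetrizableSpace A] [MeasurableSpace A] [BorelSpace A] (κ : Kernel ℝ A)
    [IsMarkovKernel κ] {f : ℝ × A → ℝ} (hf : Continuous f) (a b : ℝ) :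
    IntervalIntegrable (fun t => ∫ ξ, f (t, ξ) ∂(κ t)) volume a b := by
  obtain ⟨C, hC⟩ := exists_norm_le_of_mem_uIoc hf a b
  rw [intervalIntegrable_iff]
  refine Measure.integrableOn_of_bounded (M := C) (by simp)
    hf.stronglyMeasurable.integral_kernel_prod_right'.aestronglyMeasurable
    ((ae_restrict_iff' measurableSet_uIoc).2 (.of_forall fun t ht => ?_))
  simpa using norm_integral_le_of_norm_le_const (μ := κ t) (.of_forall (hC t ht))

/-- On a single interval, the average of a Markov kernel is the image of normalized Lebesgue
measure under a measurable map. -/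
lemma exists_measurable_intervalIntegral_comp_eq {A : Type*} [TopologicalSpace A] [CompactSpace A]
    [MeasurableSpace A] [BorelSpace A] [StandardBorelSpace A] [Nonempty A]
    (κ : Kernel ℝ A) [IsMarkovKernel κ] {a b : ℝ} (hab : a < b) :
    ∃ v : ℝ → A, Measurable v ∧ ∀ φ : A → ℝ, Continuous φ →
      ∫ t in a..b, φ (v t) = ∫ t in a..b, ∫ ξ, φ ξ ∂(κ t) := by
  have hba : 0 < b - a := sub_pos.2 hab
  let ν : Measure ℝ := (ENNReal.ofReal (b - a))⁻¹ • volume.restrict (Set.Ioc a b)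
  have hν : IsProbabilityMeasure ν := ⟨by
    simp only [ν, Measure.smul_apply, Measure.restrict_apply_univ, Real.volume_Ioc, smul_eq_mul]
    exact ENNReal.inv_mul_cancel (by simpa using hab) ENNReal.ofReal_ne_top⟩
  obtain ⟨g, hg, hgm⟩ := ((κ ∘ₖ Kernel.const Unit ν) ()).exists_measurable_map_eq
  refine ⟨fun t => g (Set.projIcc 0 1 zero_le_one (t / (b - a) - a / (b - a))),
    hg.comp (continuous_projIcc.measurable.comp (by fun_prop)), fun φ hφ => ?_⟩
  have hint : Integrable φ ((κ ∘ₖ Kernel.const Unit ν) ()) :=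
    integrable_of_continuous hφ
  have hleft := intervalIntegral.integral_comp_div_sub (a := a) (b := b)
    (fun s => φ (g (Set.projIcc 0 1 zero_le_one s))) hba.ne' (a / (b - a))
  rw [hleft, sub_self, ← sub_div, div_self hba.ne', intervalIntegral.integral_of_le zero_le_one,
    ← integral_Icc_eq_integral_Ioc, ← integral_subtype_comap measurableSet_Icc]
  simp only [Set.projIcc_val]
  change (b - a) • ∫ x : I, φ (g x) = _
  rw [← integral_map hg.aemeasurable hφ.measurable.aestronglyMeasurable, hgm,
    Kernel.integral_comp hint, Kernel.const_apply, integral_smul_measure,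
    intervalIntegral.integral_of_le hab.le, smul_smul, ENNReal.toReal_inv,
    ENNReal.toReal_ofReal hba.le, mul_inv_cancel₀ hba.ne', one_smul]

/-- If `v` reproduces the averages of `κ` on `[a, b]`, then it also nearly reproduces the averages
of a function which varies little in time. -/
lemma norm_intervalIntegral_comp_sub_le {A : Type*} [TopologicalSpace A] [CompactSpace A]
    [PseudoMetrizableSpace A]
    [MeasurableSpace A] [BorelSpace A] (κ : Kernel ℝ A) [IsMarkovKernel κ] {a b : ℝ} (hab : a ≤ b)
    {v : ℝ → A} (hvm : Measurable v)
    (hv : ∀ φ : A → ℝ, Continuous φ → ∫ t in a..b, φ (v t) = ∫ t in a..b, ∫ ξ, φ ξ ∂(κ t))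
    {f : ℝ × A → ℝ} (hf : Continuous f) {ε : ℝ}
    (hε : ∀ t ∈ Set.Icc a b, ∀ ξ, ‖f (t, ξ) - f (a, ξ)‖ ≤ ε) :
    ‖(∫ t in a..b, f (t, v t)) - ∫ t in a..b, ∫ ξ, f (t, ξ) ∂(κ t)‖ ≤ 2 * ε * (b - a) := by
  have h₁ := intervalIntegrable_comp hf hvm a b
  have h₂ := intervalIntegrable_integral_kernel κ hf a b
  have hfa : Continuous fun p : ℝ × A => f (a, p.2) := by fun_prop
  have h₃ := intervalIntegrable_comp hfa hvm a b
  have h₄ := intervalIntegrable_integral_kernel κ hfa a b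
  have key : (∫ t in a..b, f (t, v t)) - ∫ t in a..b, ∫ ξ, f (t, ξ) ∂(κ t)
      = ∫ t in a..b, ((f (t, v t) - f (a, v t)) - ∫ ξ, (f (t, ξ) - f (a, ξ)) ∂(κ t)) := by
    have h₅ : ∀ t, ∫ ξ, (f (t, ξ) - f (a, ξ)) ∂(κ t)
        = ∫ ξ, f (t, ξ) ∂(κ t) - ∫ ξ, f (a, ξ) ∂(κ t) := fun t =>
      integral_sub (integrable_of_continuous (by fun_prop)) (integrable_of_continuous (by fun_prop))
    simp_rw [h₅]
    rw [intervalIntegral.integral_sub (h₁.sub h₃) (h₂.sub h₄), intervalIntegral.integral_sub h₁ h₃,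
      intervalIntegral.integral_sub h₂ h₄, hv (fun ξ => f (a, ξ)) (by fun_prop)]
    ring
  rw [key, ← abs_of_nonneg (sub_nonneg.2 hab)]
  refine intervalIntegral.norm_integral_le_of_norm_le_const fun t ht => ?_
  rw [Set.uIoc_of_le hab] at ht
  have ht' := Set.Ioc_subset_Icc_self ht
  have h₆ : ‖∫ ξ, (f (t, ξ) - f (a, ξ)) ∂(κ t)‖ ≤ ε := by
    simpa using norm_integral_le_of_norm_le_const (μ := κ t) (.of_forall (hε t ht'))
  linarith [norm_sub_le (f (t, v t) - f (a, v t)) (∫ ξ, (f (t, ξ) - f (a, ξ)) ∂(κ t)),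
    hε t ht' (v t)]

theorem chattering_lemma
    {A : Type*} [MetricSpace A] [CompactSpace A] [Nonempty A]
    [MeasurableSpace A] [BorelSpace A]
    (T : ℝ) (hT : 0 < T) (μ : ℝ → Measure A)
    (hμprob : ∀ t, IsProbabilityMeasure (μ t))
    (hμmeas : ∀ s : Set A, MeasurableSet s → Measurable fun t => μ t s) :
    ∃ u : ℕ → ℝ → A, (∀ n, Measurable (u n)) ∧
      ∀ f : ℝ × A → ℝ, Continuous f →
        Tendsto (fun n => ∫ t in Set.Icc (0 : ℝ) T, f (t, u n t))
          atTop (nhds (∫ t in Set.Icc (0 : ℝ) T, ∫ ξ, f (t, ξ) ∂(μ t))) := by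
  let κ : Kernel ℝ A := ⟨μ, Measure.measurable_of_measurable_coe _ hμmeas⟩
  have hκ : IsMarkovKernel κ := ⟨hμprob⟩
  have hκμ : ∀ t, κ t = μ t := fun t => rfl
  simp_rw [← hκμ, integral_Icc_eq_integral_Ioc, ← intervalIntegral.integral_of_le hT.le]
  let h : ℕ → ℝ := fun n => T / (n + 1)
  have hh : ∀ n, 0 < h n := fun n => by positivity
  have hstep : ∀ n (i : ℕ), i * h n < (i + 1 : ℕ) * h n := fun n i => by
    have := hh n
    push_cast; linarith
  choose v hvm hv using fun n i => exists_measurable_intervalIntegral_comp_eq κ (hstep n i)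
  let u : ℕ → ℝ → A := fun n t => v n ⌊t / h n⌋₊ t
  have hum : ∀ n, Measurable (u n) := fun n =>
    (measurable_from_prod_countable_left (f := fun p : ℝ × ℕ => v n p.2 p.1) (hvm n)).comp
      (measurable_id.prodMk (Nat.measurable_floor.comp (by fun_prop)))
  refine ⟨u, hum, fun f hf => ?_⟩
  have huc := (isCompact_Icc.prod isCompact_univ).uniformContinuousOn_of_continuous
    (s := Set.Icc 0 T ×ˢ (Set.univ : Set A)) hf.continuousOn
  rw [Metric.tendsto_nhds]
  intro ε hε
  obtain ⟨δ, hδ, hfδ⟩ := Metric.uniformContinuousOn_iff_le.1 huc (ε / (4 * T)) (by positivity)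
  have hh0 : Tendsto h atTop (nhds 0) := by
    simpa [h, Function.comp_def] using
      (tendsto_const_div_atTop_nhds_zero_nat T).comp (tendsto_add_atTop_nat 1)
  filter_upwards [hh0.eventually (gt_mem_nhds hδ)] with n hn
  have hnT : ((n + 1 : ℕ) : ℝ) * h n = T := by
    simp only [h]; push_cast; field_simp
  have hsum : ∀ F : ℝ → ℝ, (∀ a b, IntervalIntegrable F volume a b) →
      ∫ t in (0 : ℝ)..T, F t
        = ∑ i ∈ Finset.range (n + 1), ∫ t in i * h n..(i + 1 : ℕ) * h n, F t := fun F hF => by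
    rw [intervalIntegral.sum_integral_adjacent_intervals (a := fun i : ℕ => i * h n)
      fun i _ => hF _ _]
    simp only [hnT, Nat.cast_zero, zero_mul]
  have hblock : ∀ i : ℕ, ∫ t in i * h n..(i + 1 : ℕ) * h n, f (t, u n t)
      = ∫ t in i * h n..(i + 1 : ℕ) * h n, f (t, v n i t) := fun i => by
    refine intervalIntegral.integral_congr_Ioo_of_le (hstep n i).le fun t ht => ?_
    have hfl : ⌊t / h n⌋₊ = i := by
      have ht0 : (0 : ℝ) ≤ t := le_trans (by have := hh n; positivity) ht.1.le
      rw [Nat.floor_eq_iff (div_nonneg ht0 (hh n).le), le_div_iff₀ (hh n), div_lt_iff₀ (hh n)]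
      exact ⟨ht.1.le, by simpa using ht.2⟩
    simp only [u, hfl]
  rw [Real.dist_eq, ← Real.norm_eq_abs, hsum _ (intervalIntegrable_comp hf (hum n)),
    hsum _ (intervalIntegrable_integral_kernel κ hf), ← Finset.sum_sub_distrib]
  have hle : ∀ i ∈ Finset.range (n + 1),
      ‖(∫ t in i * h n..(i + 1 : ℕ) * h n, f (t, u n t))
        - ∫ t in i * h n..(i + 1 : ℕ) * h n, ∫ ξ, f (t, ξ) ∂(κ t)‖
      ≤ 2 * (ε / (4 * T)) * h n := fun i hi => by
    have hlen : ((i + 1 : ℕ) : ℝ) * h n - i * h n = h n := by push_cast; ring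
    have hiT : ((i + 1 : ℕ) : ℝ) * h n ≤ T := by
      rw [← hnT]
      exact mul_le_mul_of_nonneg_right (by exact_mod_cast Finset.mem_range.1 hi) (hh n).le
    have hi0 : (0 : ℝ) ≤ i * h n := mul_nonneg i.cast_nonneg (hh n).le
    rw [hblock]
    refine (norm_intervalIntegral_comp_sub_le κ (hstep n i).le (hvm n i) (hv n i) hf
      fun t ht ξ => ?_).trans_eq (congrArg _ hlen)
    rw [← dist_eq_norm]
    refine hfδ (t, ξ) ⟨⟨hi0.trans ht.1, ht.2.trans hiT⟩, trivial⟩ (i * h n, ξ)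
      ⟨⟨hi0, (hstep n i).le.trans hiT⟩, trivial⟩ ?_
    rw [Prod.dist_eq, dist_self, max_eq_left dist_nonneg, Real.dist_eq,
      abs_of_nonneg (sub_nonneg.2 ht.1)]
    linarith [ht.2]
  calc _ ≤ ∑ i ∈ Finset.range (n + 1), 2 * (ε / (4 * T)) * h n := norm_sum_le_of_le _ hle
    _ = 2 * (ε / (4 * T)) * (((n + 1 : ℕ) : ℝ) * h n) := by
      rw [Finset.sum_const, Finset.card_range, nsmul_eq_mul]; ring
    _ = ε / 2 := by rw [hnT]; field_simp; norm_num
    _ < ε := half_lt_self hε
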